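/- Let V be a Ḡ-graded left R-module. The loop algebra L_π(C^gr(V)) = ⊕_{g∈G} C^gr(V)_ḡ ⊗ g acts on L_π(V) on the right by (v_ḡ ⊗ g)·(d_{ḡ′} ⊗ g′) = (v_ḡ·d_{ḡ′}) ⊗ (gg′), and this identifies L_π(C^gr(V)) with a G-graded subalgebra of C^gr(L_π(V)). Under this identification, L_π(C^gr(V)) equals the centralizer of L_π(F·1) in C^gr(L_π(V)); that is, L_π(C^gr(V)) = {δ ∈ C^gr(L_π(V)) : δ∘(1⊗h) = (1⊗h)∘δ for all h ∈ H}, where 1⊗h denotes the endomorphism of L_π(V) sending v_ḡ ⊗ g to v_ḡ ⊗ gh. -/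

import Mathlib

/-! Common definitions: gradings on algebras and modules, graded simplicity,
homogeneous endomorphisms, graded subfields, and loop modules. -/

noncomputable section

namespace GradedPaper

variable {F : Type*} [Field F]

/-- `ℳ` is a direct sum decomposition of the `F`-vector space `V`:
every vector is a finite sum of homogeneous components, and such
decompositions are unique (independence). -/
def IsVSDecomp {V ι : Type*} [AddCommGroup V] [Module F V]
    (ℳ : ι → Submodule F V) : Prop :=
  (∀ v : V, ∃ (t : Finset ι) (c : ι → V), (∀ i ∈ t, c i ∈ ℳ i) ∧ v = ∑ i ∈ t, c i) ∧
  (∀ (t : Finset ι) (c : ι → V), (∀ i ∈ t, c i ∈ ℳ i) → ∑ i ∈ t, c i = 0 →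
    ∀ i ∈ t, c i = 0)

/-- A `G`-grading on a unital associative `F`-algebra `R`:
`R = ⊕_{g ∈ G} R_g` with `1 ∈ R_0` and `R_g · R_h ⊆ R_{g+h}`.
(The abelian grading group is written additively.) -/
structure AlgebraGrading (F : Type*) [Field F] (G : Type*) [AddCommGroup G]
    (R : Type*) [Ring R] [Algebra F R] where
  comp : G → Submodule F R
  decomp : IsVSDecomp comp
  one_mem : (1 : R) ∈ comp 0
  mul_mem : ∀ {g h : G} {r s : R}, r ∈ comp g → s ∈ comp h → r * s ∈ comp (g + h)

variable {G : Type*} [AddCommGroup G] {R : Type*} [Ring R] [Algebra F R]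

/-- A grading of a left `R`-module `V` by the group `κ`, compatible with the
`G`-grading `𝒜` of `R` along the homomorphism `p : G →+ κ`
(so `R_g · V_k ⊆ V_{p g + k}`).  For `p = id` this is a `G`-graded module;
for `p : G →+ G ⧸ H` the natural projection, this is a `G/H`-graded module
(for the induced `G/H`-grading of `R`). -/
structure ModuleGrading (𝒜 : AlgebraGrading F G R) {κ : Type*} [AddCommGroup κ]
    (p : G →+ κ) (V : Type*) [AddCommGroup V] [Module F V] [Module R V]
    [IsScalarTower F R V] where
  comp : κ → Submodule F V
  decomp : IsVSDecomp comp
  smul_mem : ∀ {g : G} {k : κ} {r : R} {v : V},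
    r ∈ 𝒜.comp g → v ∈ comp k → r • v ∈ comp (p g + k)

/-- `W` is a graded submodule: every element of `W` is a finite sum of
homogeneous elements of `W`. -/
def IsGradedSubmodule {κ V : Type*} [AddCommGroup V] [Module F V] [Module R V]
    (ℳ : κ → Submodule F V) (W : Submodule R V) : Prop :=
  ∀ w ∈ W, ∃ (t : Finset κ) (c : κ → V),
    (∀ i ∈ t, c i ∈ ℳ i ∧ c i ∈ W) ∧ w = ∑ i ∈ t, c i

/-- The graded module with components `ℳ` is graded simple. -/
def IsGradedSimpleModule (R : Type*) [Ring R] {κ V : Type*} [AddCommGroup V]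
    [Module F V] [Module R V] (ℳ : κ → Submodule F V) : Prop :=
  (∃ v : V, v ≠ 0) ∧ ∀ W : Submodule R V, IsGradedSubmodule ℳ W → W = ⊥ ∨ W = ⊤

/-- An `R`-module endomorphism of `V` is homogeneous of degree `d`. -/
def IsHomogeneousEnd {κ V : Type*} [Add κ] [AddCommGroup V] [Module F V]
    [Module R V] (ℳ : κ → Submodule F V) (d : κ) (f : Module.End R V) : Prop :=
  ∀ ⦃k : κ⦄ ⦃v : V⦄, v ∈ ℳ k → f v ∈ ℳ (k + d)

/-- The degree-`d` homogeneous component of the (graded) centralizer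
`C(V) = End_R(V)`. -/
def homogComp {κ V : Type*} [Add κ] [AddCommGroup V] [Module F V] [Module R V]
    [SMulCommClass R F V] (ℳ : κ → Submodule F V) (d : κ) :
    Submodule F (Module.End R V) where
  carrier := {f | IsHomogeneousEnd ℳ d f}
  add_mem' := fun hf hg k v hv => (ℳ _).add_mem (hf hv) (hg hv)
  zero_mem' := fun k v hv => (ℳ _).zero_mem
  smul_mem' := fun c f hf k v hv => by
    simpa using (ℳ _).smul_mem c (hf hv)

/-- `f` belongs to the graded centralizer: it is a finite sum of homogeneous
`R`-module endomorphisms. -/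
def IsInGradedCentralizer {κ V : Type*} [Add κ] [AddCommGroup V] [Module F V]
    [Module R V] (ℳ : κ → Submodule F V) (f : Module.End R V) : Prop :=
  ∃ (t : Finset κ) (c : κ → Module.End R V),
    (∀ d ∈ t, IsHomogeneousEnd ℳ d (c d)) ∧ f = ∑ d ∈ t, c d

/-- The module `V` is central (Schurian): its centralizer consists of the
scalar multiples of the identity. -/
def IsCentralModule (F : Type*) [Field F] (R V : Type*) [Ring R] [AddCommGroup V]
    [Module F V] [Module R V] : Prop :=
  ∀ f : Module.End R V, ∃ a : F, ∀ v : V, f v = a • v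

/-- A graded subfield of a graded algebra with homogeneous components `𝒟`:
a graded unital subalgebra (given by its homogeneous components `comp`)
which is commutative and in which every nonzero homogeneous element is
invertible. -/
structure GradedSubfield {κ : Type*} [AddCommGroup κ] {A : Type*} [Ring A]
    [Module F A] (𝒟 : κ → Submodule F A) where
  comp : κ → Submodule F A
  le : ∀ k, comp k ≤ 𝒟 k
  one_mem : (1 : A) ∈ comp 0
  mul_mem : ∀ {g h : κ} {a b : A}, a ∈ comp g → b ∈ comp h → a * b ∈ comp (g + h)
  comm : ∀ {g h : κ} {a b : A}, a ∈ comp g → b ∈ comp h → a * b = b * a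
  inv_mem : ∀ {g : κ} {a : A}, a ∈ comp g → a ≠ 0 →
    ∃ b ∈ comp (-g), a * b = 1 ∧ b * a = 1

/-- The support of a graded subfield. -/
def GradedSubfield.support {κ : Type*} [AddCommGroup κ] {A : Type*} [Ring A]
    [Module F A] {𝒟 : κ → Submodule F A} (𝒦 : GradedSubfield 𝒟) : Set κ :=
  {k | 𝒦.comp k ≠ ⊥}

/-- A graded subfield is maximal if the only graded subfield containing it
is itself. -/
def GradedSubfield.IsMaximal {κ : Type*} [AddCommGroup κ] {A : Type*} [Ring A]
    [Module F A] {𝒟 : κ → Submodule F A} (𝒦 : GradedSubfield 𝒟) : Prop :=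
  ∀ 𝒦' : GradedSubfield 𝒟, (∀ k, 𝒦.comp k ≤ 𝒦'.comp k) → ∀ k, 𝒦'.comp k = 𝒦.comp k

/-- A graded subfield is isomorphic, as a graded algebra, to the group algebra
of its support: it has a homogeneous basis `c` (one-dimensional components)
which is multiplicative. -/
def GradedSubfield.IsGroupAlgebraOfSupport {κ : Type*} [AddCommGroup κ]
    {A : Type*} [Ring A] [Module F A] {𝒟 : κ → Submodule F A}
    (𝒦 : GradedSubfield 𝒟) : Prop :=
  ∃ c : κ → A, c 0 = 1 ∧
    (∀ k ∈ 𝒦.support, c k ∈ 𝒦.comp k ∧ c k ≠ 0 ∧ 𝒦.comp k = Submodule.span F {c k}) ∧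
    (∀ k₁ ∈ 𝒦.support, ∀ k₂ ∈ 𝒦.support, c (k₁ + k₂) = c k₁ * c k₂)

section Loop

variable {Q₁ Q₂ : Type*}

/-- The underlying space of the loop module: inside `V ⊗ F[Q₁] ≅ (Q₁ →₀ V)`,
the subspace `⊕_{a ∈ Q₁} V_{s a} ⊗ a` of finitely supported functions `f` with
`f a ∈ V_{s a}`. -/
def LoopSubmodule {V : Type*} [AddCommGroup V] [Module F V] (s : Q₁ → Q₂)
    (ℳ : Q₂ → Submodule F V) : Submodule F (Q₁ →₀ V) where
  carrier := {f | ∀ a : Q₁, f a ∈ ℳ (s a)}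
  add_mem' := fun hf hg a => by simpa using (ℳ _).add_mem (hf a) (hg a)
  zero_mem' := fun a => by simpa using (ℳ _).zero_mem
  smul_mem' := fun c f hf a => by simpa using (ℳ _).smul_mem c (hf a)

/-- The degree-`a` homogeneous component of the loop module. -/
def loopComp {V : Type*} [AddCommGroup V] [Module F V] (s : Q₁ → Q₂)
    (ℳ : Q₂ → Submodule F V) (a : Q₁) : Submodule F ↥(LoopSubmodule s ℳ) where
  carrier := {x | ∀ b : Q₁, b ≠ a → (x : Q₁ →₀ V) b = 0}
  add_mem' := by
    intro x y hx hy b hb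
    simp [hx b hb, hy b hb]
  zero_mem' := by intro b hb; simp
  smul_mem' := by
    intro c x hx b hb
    simp [hx b hb]

/-- The scalar multiplication of a (possibly non-canonical) module structure,
written explicitly. -/
def msmul {S M : Type*} [Semiring S] [AddCommMonoid M] (i : Module S M)
    (r : S) (x : M) : M :=
  @SMul.smul S M i.toDistribMulAction.toMulAction.toSMul r x

/-- `i` is the loop-module `R`-action: a homogeneous element `r ∈ R_g` acts on
`v ⊗ a` by `r • (v ⊗ a) = (r v) ⊗ (p g + a)`; in terms of values of finitely
supported functions, `(r • x) a = r • x (a - p g)`. -/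
def IsLoopSMul [AddCommGroup Q₁] (𝒜 : AlgebraGrading F G R) (p : G →+ Q₁)
    (s : Q₁ → Q₂) {V : Type*} [AddCommGroup V] [Module F V] [Module R V]
    (ℳ : Q₂ → Submodule F V) (i : Module R ↥(LoopSubmodule s ℳ)) : Prop :=
  ∀ {g : G} {r : R}, r ∈ 𝒜.comp g → ∀ (x : ↥(LoopSubmodule s ℳ)) (a : Q₁),
    ((msmul i r x : ↥(LoopSubmodule s ℳ)) : Q₁ →₀ V) a = r • ((x : Q₁ →₀ V) (a - p g))

/-- The right-shift operator `1 ⊗ d` on the loop module: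
`v ⊗ a ↦ v ⊗ (a + d)`. -/
def rshiftFun [AddCommGroup Q₁] {V : Type*} [AddCommGroup V] [Module F V]
    (s : Q₁ → Q₂) (ℳ : Q₂ → Submodule F V) (d : Q₁) (hd : ∀ a, s (a + d) = s a) :
    ↥(LoopSubmodule s ℳ) → ↥(LoopSubmodule s ℳ) :=
  fun x => ⟨Finsupp.equivMapDomain (Equiv.addRight d) (x : Q₁ →₀ V), by
    intro a
    have key : Finsupp.equivMapDomain (Equiv.addRight d) (x : Q₁ →₀ V) a
        = (x : Q₁ →₀ V) (a - d) := by
      rw [Finsupp.equivMapDomain_apply]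
      congr 1
      simp [sub_eq_add_neg]
    rw [key]
    have h1 : s (a - d) = s a := by
      have h2 := hd (a - d)
      rw [show a - d + d = a by abel] at h2
      exact h2.symm
    exact h1 ▸ x.2 (a - d)⟩

end Loop

section Twist

variable (H : AddSubgroup G)

/-- `i` is the `R`-module structure on (the finitely-supported-functions model
`{f : G/H →₀ V | f q ∈ V_q}` of) the `G/H`-graded module `V`, twisted by the
scalar factors `cf`: a homogeneous `r ∈ R_g` acts on `v ∈ V_k` by
`r • v = cf g k • (r v) ∈ V_{ḡ + k}`. -/
def IsTwistedSMul (𝒜 : AlgebraGrading F G R) {V : Type*} [AddCommGroup V]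
    [Module F V] [Module R V] (ℳ : G ⧸ H → Submodule F V) (cf : G → G ⧸ H → F)
    (i : Module R ↥(LoopSubmodule (id : G ⧸ H → G ⧸ H) ℳ)) : Prop :=
  ∀ {g : G} {r : R}, r ∈ 𝒜.comp g → ∀ (x : ↥(LoopSubmodule (id : G ⧸ H → G ⧸ H) ℳ))
    (q : G ⧸ H),
    ((msmul i r x : ↥(LoopSubmodule (id : G ⧸ H → G ⧸ H) ℳ)) : (G ⧸ H) →₀ V) q
      = cf g (q - QuotientAddGroup.mk g) •
          (r • ((x : (G ⧸ H) →₀ V) (q - QuotientAddGroup.mk g)))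

end Twist

section Pregrading

/-- A `G`-pregrading of the left `R`-module `V`: a family of subspaces with
`V = Σ_g V_g` and `R_g · V_h ⊆ V_{g+h}`. -/
def IsPregrading (𝒜 : AlgebraGrading F G R) {V : Type*} [AddCommGroup V]
    [Module F V] [Module R V] (P : G → Submodule F V) : Prop :=
  (⨆ g, P g) = (⊤ : Submodule F V) ∧
  ∀ {g k : G} {r : R} {v : V}, r ∈ 𝒜.comp g → v ∈ P k → r • v ∈ P (g + k)

/-- A pregrading is thin if it admits no proper refinement. -/
def IsThinPregrading (𝒜 : AlgebraGrading F G R) {V : Type*} [AddCommGroup V]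
    [Module F V] [Module R V] (P : G → Submodule F V) : Prop :=
  IsPregrading 𝒜 P ∧
  ∀ P' : G → Submodule F V, IsPregrading 𝒜 P' → (∀ g, P' g ≤ P g) → P' = P

end Pregrading

section Extras

open TensorProduct

variable {G : Type*} [AddCommGroup G] {R : Type*} [Ring R] [Algebra F R]

lemma mk'_add_right_mem (H : AddSubgroup G) (h : ↥H) (a : G) :
    (QuotientAddGroup.mk' H) (a + (h : G)) = (QuotientAddGroup.mk' H) a := by
  simpa using QuotientAddGroup.mk_add_of_mem a h.2

/-- The right-shift operator `1 ⊗ h`, `h ∈ H`, on the loop module `L_π(V)`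
(for `π : G → G/H` the natural projection): `v ⊗ g ↦ v ⊗ (g + h)`. -/
def loopShift (H : AddSubgroup G) {V : Type*} [AddCommGroup V] [Module F V]
    (ℳ : G ⧸ H → Submodule F V) (h : ↥H) :
    ↥(LoopSubmodule (⇑(QuotientAddGroup.mk' H)) ℳ) →
      ↥(LoopSubmodule (⇑(QuotientAddGroup.mk' H)) ℳ) :=
  rshiftFun (⇑(QuotientAddGroup.mk' H)) ℳ (h : G) (mk'_add_right_mem H h)

lemma twist_elt_mem (H : AddSubgroup G) (ξ : G ⧸ H → G)
    (hξ : ∀ q, (QuotientAddGroup.mk' H) (ξ q) = q) (g : G) (k : G ⧸ H) :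
    g + ξ k - ξ ((QuotientAddGroup.mk' H) g + k) ∈ H := by
  have h0 : (QuotientAddGroup.mk' H) (g + ξ k - ξ ((QuotientAddGroup.mk' H) g + k)) = 0 := by
    rw [map_sub, map_add, hξ, hξ]
    abel
  exact (QuotientAddGroup.eq_zero_iff _).mp h0

/-- The scalar factors `χ(g + ξ(k̄) - ξ(ḡ + k̄))` defining the module `V`
twisted by a character `χ` of `H`, relative to the section `ξ` of the natural
projection `π : G → G/H`. -/
def twistFactor (H : AddSubgroup G) (ξ : G ⧸ H → G)
    (hξ : ∀ q, (QuotientAddGroup.mk' H) (ξ q) = q) (χ : AddChar ↥H Fˣ) :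
    G → G ⧸ H → F :=
  fun g k =>
    ((χ ⟨g + ξ k - ξ ((QuotientAddGroup.mk' H) g + k), twist_elt_mem H ξ hξ g k⟩ : Fˣ) : F)

/-- The `G/H`-grading induced on a quotient `W/N` of a `G`-graded module `W`:
the component of degree `ḡ` is the image of `⊕_{h ∈ H} W_{g+h}`. -/
def quotGradeComp {W : Type*} [AddCommGroup W] [Module F W] [Module R W]
    [IsScalarTower F R W] (H : AddSubgroup G) (ℳ : G → Submodule F W)
    (N : Submodule R W) : G ⧸ H → Submodule F (W ⧸ N) :=
  fun q => ⨆ g : {g : G // (QuotientAddGroup.mk' H) g = q},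
    (ℳ (g : G)).map ((N.mkQ).restrictScalars F)

/-- The submodule `W · ker ρ` of `W`, where `ρ` is the homomorphism of unital
algebras `𝓕 → F` determined by `ρ(c_h) = ρ h` on the multiplicative
homogeneous basis `c` of the graded subfield `𝓕 ≅ FH` of the centralizer:
`W · ker ρ = Σ_{h ∈ H} W·(c_h - ρ(h)·1)`. -/
def kerSubmodule {W : Type*} [AddCommGroup W] [Module F W] [Module R W]
    [SMulCommClass R F W] {H : AddSubgroup G} (c : ↥H → Module.End R W)
    (ρ : ↥H → F) : Submodule R W :=
  ⨆ h : ↥H, LinearMap.range (c h - ρ h • (1 : Module.End R W))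

/-- The grading of the coordinate space `ι' → F` with coordinates of degrees
`gdeg`. -/
def coordComp {ι' : Type*} (gdeg : ι' → G) (g : G) : Submodule F (ι' → F) where
  carrier := {x | ∀ i, gdeg i ≠ g → x i = 0}
  add_mem' := fun hx hy i hi => by
    simp only [Pi.add_apply, hx i hi, hy i hi, add_zero]
  zero_mem' := fun i hi => rfl
  smul_mem' := fun a x hx i hi => by
    simp only [Pi.smul_apply, hx i hi, smul_zero]

/-- The natural grading of a tensor product of two graded algebras (or graded
vector spaces): the component of degree `g` is spanned by the products
`a ⊗ b` of homogeneous elements with `deg a + deg b = g`. -/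
def tensorGradeComp {A B : Type*} [AddCommGroup A] [Module F A] [AddCommGroup B]
    [Module F B] (Ac : G → Submodule F A) (Bc : G → Submodule F B) (g : G) :
    Submodule F (A ⊗[F] B) :=
  Submodule.span F {x | ∃ (g₁ g₂ : G) (a : A) (b : B),
    g₁ + g₂ = g ∧ a ∈ Ac g₁ ∧ b ∈ Bc g₂ ∧ x = a ⊗ₜ[F] b}

/-- The action of `r ∈ R` on an `R`-module `V`, viewed as an `F`-linear
endomorphism of `V`; i.e. the representation `R → End_F(V)`. -/
def actionEnd (F : Type*) [Field F] {R V : Type*} [Ring R] [AddCommGroup V]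
    [Module F V] [Module R V] [SMulCommClass R F V] (r : R) : Module.End F V where
  toFun v := r • v
  map_add' := smul_add r
  map_smul' a v := by simpa using smul_comm r a v

end Extras

end GradedPaper

namespace GradedPaper

universe u₁ u₂ u₃ u₄

section Helpers

variable {F : Type*} [Field F] {G : Type*} [AddCommGroup G]
    {R : Type*} [Ring R] [Algebra F R] {H : AddSubgroup G}
    {V : Type*} [AddCommGroup V] [Module F V]

/-- The element `v ⊗ a` of the loop module. -/
def loopSingle (ℳ : G ⧸ H → Submodule F V) (a : G) (v : V)
    (hv : v ∈ ℳ (QuotientAddGroup.mk' H a)) :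
    ↥(LoopSubmodule (⇑(QuotientAddGroup.mk' H)) ℳ) :=
  ⟨Finsupp.single a v, by
    classical
    intro b
    rw [Finsupp.single_apply]
    split_ifs with h
    · subst h; exact hv
    · exact Submodule.zero_mem _⟩

lemma loopSingle_coe (ℳ : G ⧸ H → Submodule F V) (a : G) (v : V)
    (hv : v ∈ ℳ (QuotientAddGroup.mk' H a)) :
    ((loopSingle ℳ a v hv : ↥(LoopSubmodule (⇑(QuotientAddGroup.mk' H)) ℳ)) : G →₀ V)
      = Finsupp.single a v := rfl

lemma loopSingle_mem (ℳ : G ⧸ H → Submodule F V) (a : G) (v : V)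
    (hv : v ∈ ℳ (QuotientAddGroup.mk' H a)) :
    loopSingle ℳ a v hv ∈ loopComp (⇑(QuotientAddGroup.mk' H)) ℳ a := by
  intro b hb
  rw [loopSingle_coe, Finsupp.single_eq_of_ne hb]

lemma loop_induction (ℳ : G ⧸ H → Submodule F V)
    {P : ↥(LoopSubmodule (⇑(QuotientAddGroup.mk' H)) ℳ) → Prop}
    (h0 : P 0) (hadd : ∀ x y, P x → P y → P (x + y))
    (hs : ∀ a v hv, P (loopSingle ℳ a v hv)) (x) : P x := by
  have : x = ∑ a ∈ (x : G →₀ V).support, loopSingle ℳ a ((x : G →₀ V) a) (x.2 a) := by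
    apply Subtype.ext
    rw [Submodule.coe_sum]
    simp only [loopSingle_coe]
    exact (Finsupp.sum_single (x : G →₀ V)).symm
  rw [this]
  exact Finset.sum_induction _ P hadd h0 (fun a _ => hs a _ _)

/-- The sum-of-coordinates map. -/
def loopSum (ℳ : G ⧸ H → Submodule F V) :
    ↥(LoopSubmodule (⇑(QuotientAddGroup.mk' H)) ℳ) →+ V where
  toFun x := (x : G →₀ V).sum fun _ v => v
  map_zero' := by simp
  map_add' x y := by
    rw [Submodule.coe_add]
    exact Finsupp.sum_add_index' (fun _ => rfl) (fun _ _ _ => rfl)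

lemma loopSum_single (ℳ : G ⧸ H → Submodule F V) (a v hv) :
    loopSum ℳ (loopSingle ℳ a v hv) = v := by
  show (Finsupp.single a v).sum (fun _ v => v) = v
  exact Finsupp.sum_single_index rfl

lemma loopSum_of_mem (ℳ : G ⧸ H → Submodule F V) (a : G) (x)
    (hx : x ∈ loopComp (⇑(QuotientAddGroup.mk' H)) ℳ a) :
    loopSum ℳ x = (x : G →₀ V) a := by
  have : x = loopSingle ℳ a ((x : G →₀ V) a) (x.2 a) := by
    apply Subtype.ext
    ext b
    rw [loopSingle_coe]
    by_cases h : b = a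
    · subst h; simp
    · rw [hx b h, Finsupp.single_eq_of_ne h]
  conv_lhs => rw [this]
  exact loopSum_single _ _ _ _

lemma loopShift_apply (ℳ : G ⧸ H → Submodule F V) (h : ↥H) (x) (a : G) :
    ((loopShift H ℳ h x : ↥(LoopSubmodule (⇑(QuotientAddGroup.mk' H)) ℳ)) : G →₀ V) a
      = (x : G →₀ V) (a - h) := by
  show Finsupp.equivMapDomain (Equiv.addRight (h : G)) (x : G →₀ V) a = _
  rw [Finsupp.equivMapDomain_apply]
  congr 1
  simp [sub_eq_add_neg]

lemma loopShift_single (ℳ : G ⧸ H → Submodule F V) (h : ↥H) (a v hv hv') :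
    loopShift H ℳ h (loopSingle ℳ a v hv) = loopSingle ℳ (a + h) v hv' := by
  classical
  apply Subtype.ext
  ext b
  rw [loopShift_apply, loopSingle_coe, loopSingle_coe, Finsupp.single_apply, Finsupp.single_apply]
  simp only [eq_sub_iff_add_eq]

/-- An additive map on the loop module which does not distinguish `v ⊗ a` and `v ⊗ a'`
for `a, a'` in the same coset kills the kernel of the sum map. -/
lemma loop_kill (ℳ : G ⧸ H → Submodule F V) (hdec : IsVSDecomp ℳ)
    (N : ↥(LoopSubmodule (⇑(QuotientAddGroup.mk' H)) ℳ) →+ V)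
    (hN : ∀ a a' v hv hv', QuotientAddGroup.mk' H a = QuotientAddGroup.mk' H a' →
      N (loopSingle ℳ a v hv) = N (loopSingle ℳ a' v hv'))
    (x) (hx : loopSum ℳ x = 0) : N x = 0 := by
  classical
  obtain ⟨ξ, hξ⟩ := (QuotientAddGroup.mk'_surjective H).hasRightInverse
  have hmem : ∀ z : ↥(LoopSubmodule (⇑(QuotientAddGroup.mk' H)) ℳ),
      Finsupp.mapDomain (fun a => ξ (QuotientAddGroup.mk' H a)) (z : G →₀ V)
        ∈ LoopSubmodule (⇑(QuotientAddGroup.mk' H)) ℳ := by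
    intro z
    refine Submodule.sum_mem _ fun a _ => ?_
    refine (loopSingle ℳ (ξ (QuotientAddGroup.mk' H a)) _ ?_).2
    rw [hξ]; exact z.2 a
  have key : ∀ z, N z = N ⟨_, hmem z⟩ := by
    refine loop_induction ℳ ?_ ?_ ?_
    · congr 1
    · intro y z hy hz
      rw [map_add, hy, hz, ← map_add]
      congr 1
      apply Subtype.ext
      exact Finsupp.mapDomain_add.symm
    · intro a v hv
      have hv' : v ∈ ℳ (QuotientAddGroup.mk' H (ξ (QuotientAddGroup.mk' H a))) := by
        rw [hξ]; exact hv
      rw [hN a (ξ (QuotientAddGroup.mk' H a)) v hv hv' (hξ _).symm]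
      congr 1
      apply Subtype.ext
      simp only [loopSingle_coe, Finsupp.mapDomain_single]
  rw [key]
  suffices h : Finsupp.mapDomain (fun a => ξ (QuotientAddGroup.mk' H a)) (x : G →₀ V) = 0 by
    have : (⟨_, hmem x⟩ : ↥(LoopSubmodule (⇑(QuotientAddGroup.mk' H)) ℳ)) = 0 := Subtype.ext h
    rw [this, map_zero]
  set S := (x : G →₀ V).support with hS
  set T := S.image (QuotientAddGroup.mk' H) with hT
  have hmaps : ∀ a ∈ S, QuotientAddGroup.mk' H a ∈ T := fun a ha => Finset.mem_image_of_mem _ ha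
  have hc := hdec.2 T
    (fun q => ∑ a ∈ S with QuotientAddGroup.mk' H a = q, (x : G →₀ V) a)
    (by
      intro q _
      refine Submodule.sum_mem _ fun a ha => ?_
      rw [← (Finset.mem_filter.mp ha).2]; exact x.2 a)
    (by
      rw [Finset.sum_fiberwise_of_maps_to hmaps]
      exact hx)
  unfold Finsupp.mapDomain Finsupp.sum
  rw [← Finset.sum_fiberwise_of_maps_to hmaps]
  refine Finset.sum_eq_zero fun q hq => ?_
  have h2 := hc q hq
  calc _ = ∑ a ∈ S with QuotientAddGroup.mk' H a = q, Finsupp.single (ξ q) ((x : G →₀ V) a) := by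
          refine Finset.sum_congr rfl fun a ha => ?_
          beta_reduce
          rw [(Finset.mem_filter.mp ha).2]
    _ = Finsupp.single (ξ q) (∑ a ∈ S with QuotientAddGroup.mk' H a = q, (x : G →₀ V) a) := by
          rw [Finsupp.single_finsetSum]
    _ = 0 := by rw [h2, Finsupp.single_zero]

variable [Module R V] [IsScalarTower F R V]

lemma loop_smul_apply (𝒜 : AlgebraGrading F G R) (ℳ : G ⧸ H → Submodule F V)
    [iL : Module R ↥(LoopSubmodule (⇑(QuotientAddGroup.mk' H)) ℳ)]
    (hloop : IsLoopSMul 𝒜 (AddMonoidHom.id G) (⇑(QuotientAddGroup.mk' H)) ℳ iL)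
    {g : G} {r : R} (hr : r ∈ 𝒜.comp g)
    (x : ↥(LoopSubmodule (⇑(QuotientAddGroup.mk' H)) ℳ)) (a : G) :
    ((r • x : ↥(LoopSubmodule (⇑(QuotientAddGroup.mk' H)) ℳ)) : G →₀ V) a
      = r • ((x : G →₀ V) (a - g)) := hloop hr x a

lemma homog_smul_induction (𝒜 : AlgebraGrading F G R) {P : R → Prop}
    (h0 : P 0) (hadd : ∀ x y, P x → P y → P (x + y))
    (hs : ∀ g, ∀ r ∈ 𝒜.comp g, P r) (r : R) : P r := by
  obtain ⟨t, c, hc, rfl⟩ := 𝒜.decomp.1 r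
  exact Finset.sum_induction _ P hadd h0 (fun i hi => hs i _ (hc i hi))

/-- The sum map is `R`-linear. -/
def loopSumLin (𝒜 : AlgebraGrading F G R) (𝒱 : ModuleGrading 𝒜 (QuotientAddGroup.mk' H) V)
    [iL : Module R ↥(LoopSubmodule (⇑(QuotientAddGroup.mk' H)) 𝒱.comp)]
    (hloop : IsLoopSMul 𝒜 (AddMonoidHom.id G) (⇑(QuotientAddGroup.mk' H)) 𝒱.comp iL) :
    ↥(LoopSubmodule (⇑(QuotientAddGroup.mk' H)) 𝒱.comp) →ₗ[R] V where
  toFun := loopSum 𝒱.comp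
  map_add' := map_add _
  map_smul' r x := by
    classical
    simp only [RingHom.id_apply]
    revert r
    refine homog_smul_induction 𝒜 (by rw [zero_smul, zero_smul, map_zero])
      (fun r s hr hs => by rw [add_smul, add_smul, map_add, hr, hs]) ?_
    intro g r hr
    revert x
    refine loop_induction _ (by rw [smul_zero, map_zero, smul_zero])
      (fun x y hx hy => by rw [smul_add, map_add, map_add, smul_add, hx, hy]) ?_
    intro a v hv
    have hv' : r • v ∈ 𝒱.comp (QuotientAddGroup.mk' H (g + a)) := by
      rw [map_add]; exact 𝒱.smul_mem hr hv
    have : r • loopSingle 𝒱.comp a v hv = loopSingle 𝒱.comp (g + a) (r • v) hv' := by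
      apply Subtype.ext
      ext b
      rw [loop_smul_apply 𝒜 _ hloop hr, loopSingle_coe, loopSingle_coe,
        Finsupp.single_apply, Finsupp.single_apply]
      simp only [eq_sub_iff_add_eq, add_comm a g]
      split_ifs <;> simp
    rw [this, loopSum_single, loopSum_single]

lemma loopSum_surj (𝒜 : AlgebraGrading F G R)
    (𝒱 : ModuleGrading 𝒜 (QuotientAddGroup.mk' H) V) :
    Function.Surjective (loopSum 𝒱.comp) := by
  intro v
  obtain ⟨t, c, hc, rfl⟩ := 𝒱.decomp.1 v
  refine Finset.sum_induction c (fun v => ∃ x, loopSum 𝒱.comp x = v) ?_ ⟨0, map_zero _⟩ ?_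
  · rintro _ _ ⟨x, rfl⟩ ⟨y, rfl⟩
    exact ⟨x + y, map_add _ _ _⟩
  · intro q hq
    obtain ⟨a, rfl⟩ := QuotientAddGroup.mk'_surjective H q
    exact ⟨loopSingle _ a _ (hc _ hq), loopSum_single _ _ _ _⟩

lemma exists_end (𝒜 : AlgebraGrading F G R)
    (𝒱 : ModuleGrading 𝒜 (QuotientAddGroup.mk' H) V)
    [iL : Module R ↥(LoopSubmodule (⇑(QuotientAddGroup.mk' H)) 𝒱.comp)]
    (hloop : IsLoopSMul 𝒜 (AddMonoidHom.id G) (⇑(QuotientAddGroup.mk' H)) 𝒱.comp iL)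
    (g : G) (δ : Module.End R ↥(LoopSubmodule (⇑(QuotientAddGroup.mk' H)) 𝒱.comp))
    (hδ : IsHomogeneousEnd (loopComp (⇑(QuotientAddGroup.mk' H)) 𝒱.comp) g δ)
    (hN : ∀ a a' v hv hv', QuotientAddGroup.mk' H a = QuotientAddGroup.mk' H a' →
      loopSum 𝒱.comp (δ (loopSingle 𝒱.comp a v hv))
        = loopSum 𝒱.comp (δ (loopSingle 𝒱.comp a' v hv'))) :
    ∃ d : Module.End R V, IsHomogeneousEnd 𝒱.comp (QuotientAddGroup.mk' H g) d ∧
      ∀ (x : ↥(LoopSubmodule (⇑(QuotientAddGroup.mk' H)) 𝒱.comp)) (a : G),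
        ((δ x : ↥(LoopSubmodule (⇑(QuotientAddGroup.mk' H)) 𝒱.comp)) : G →₀ V) a
          = d ((x : G →₀ V) (a - g)) := by
  classical
  let ω := loopSumLin 𝒜 𝒱 hloop
  have hω : Function.Surjective ω := loopSum_surj 𝒜 𝒱
  have hker : LinearMap.ker ω ≤ LinearMap.ker (ω ∘ₗ δ) := by
    intro x hx
    exact loop_kill 𝒱.comp 𝒱.decomp ((loopSum 𝒱.comp).comp δ.toAddMonoidHom) hN x hx
  let d : Module.End R V :=
    ((LinearMap.ker ω).liftQ (ω ∘ₗ δ) hker) ∘ₗ (ω.quotKerEquivOfSurjective hω).symm.toLinearMap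
  have hd : ∀ x, d (loopSum 𝒱.comp x) = loopSum 𝒱.comp (δ x) := by
    intro x
    have : (ω.quotKerEquivOfSurjective hω).symm (ω x) = (LinearMap.ker ω).mkQ x := by
      rw [LinearEquiv.symm_apply_eq]; rfl
    show ((LinearMap.ker ω).liftQ (ω ∘ₗ δ) hker)
      ((ω.quotKerEquivOfSurjective hω).symm (ω x)) = _
    rw [this]
    rfl
  have hd1 : ∀ a v hv, d v = ((δ (loopSingle 𝒱.comp a v hv) :
      ↥(LoopSubmodule (⇑(QuotientAddGroup.mk' H)) 𝒱.comp)) : G →₀ V) (a + g) := by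
    intro a v hv
    rw [← loopSum_of_mem _ _ _ (hδ (loopSingle_mem _ a v hv)), ← hd, loopSum_single]
  refine ⟨d, ?_, ?_⟩
  · intro q v hv
    obtain ⟨a, rfl⟩ := QuotientAddGroup.mk'_surjective H q
    rw [hd1 a v hv, ← map_add]
    exact (δ _).2 _
  · intro x a
    revert x
    refine loop_induction _ 
      (by rw [map_zero]; exact (map_zero d).symm)
      (fun x y hx hy => by
        rw [map_add, Submodule.coe_add, Submodule.coe_add, Finsupp.add_apply, Finsupp.add_apply,
          map_add, hx, hy]) ?_
    intro b v hv
    rw [loopSingle_coe]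
    by_cases h : a = b + g
    · subst h
      rw [← hd1, add_sub_cancel_right, Finsupp.single_eq_same]
    · rw [hδ (loopSingle_mem _ b v hv) a h, Finsupp.single_eq_of_ne, map_zero]
      intro h'
      exact h (by rw [← h']; abel)

/-- The additive endomorphism `d ⊗ g` of the loop module. -/
def loopEndAdd (ℳ : G ⧸ H → Submodule F V) (g : G) (d : Module.End R V)
    (hd : IsHomogeneousEnd ℳ (QuotientAddGroup.mk' H g) d)
    (x : ↥(LoopSubmodule (⇑(QuotientAddGroup.mk' H)) ℳ)) :
    ↥(LoopSubmodule (⇑(QuotientAddGroup.mk' H)) ℳ) :=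
  ⟨(Finsupp.equivMapDomain (Equiv.addRight g) (x : G →₀ V)).mapRange d (map_zero d), by
    intro a
    rw [Finsupp.mapRange_apply, Finsupp.equivMapDomain_apply]
    have := hd (x.2 ((Equiv.addRight g).symm a))
    rw [← map_add] at this
    simpa using this⟩

lemma loopEndAdd_apply (ℳ : G ⧸ H → Submodule F V) (g : G) (d : Module.End R V)
    (hd : IsHomogeneousEnd ℳ (QuotientAddGroup.mk' H g) d) (x) (a : G) :
    ((loopEndAdd ℳ g d hd x : ↥(LoopSubmodule (⇑(QuotientAddGroup.mk' H)) ℳ)) : G →₀ V) a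
      = d ((x : G →₀ V) (a - g)) := by
  show (Finsupp.equivMapDomain (Equiv.addRight g) (x : G →₀ V)).mapRange d (map_zero d) a = _
  rw [Finsupp.mapRange_apply, Finsupp.equivMapDomain_apply]
  congr 2
  simp [sub_eq_add_neg]

lemma loopEndAdd_add (ℳ : G ⧸ H → Submodule F V) (g : G) (d : Module.End R V)
    (hd : IsHomogeneousEnd ℳ (QuotientAddGroup.mk' H g) d) (x y) :
    loopEndAdd ℳ g d hd (x + y) = loopEndAdd ℳ g d hd x + loopEndAdd ℳ g d hd y := by
  apply Subtype.ext; ext a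
  rw [Submodule.coe_add, Finsupp.add_apply, loopEndAdd_apply, loopEndAdd_apply, loopEndAdd_apply,
    Submodule.coe_add, Finsupp.add_apply, map_add]

/-- The endomorphism `d ⊗ g` of the loop module. -/
def loopEnd (𝒜 : AlgebraGrading F G R)
    (𝒱 : ModuleGrading 𝒜 (QuotientAddGroup.mk' H) V)
    [iL : Module R ↥(LoopSubmodule (⇑(QuotientAddGroup.mk' H)) 𝒱.comp)]
    (hloop : IsLoopSMul 𝒜 (AddMonoidHom.id G) (⇑(QuotientAddGroup.mk' H)) 𝒱.comp iL)
    (g : G) (d : Module.End R V)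
    (hd : IsHomogeneousEnd 𝒱.comp (QuotientAddGroup.mk' H g) d) :
    Module.End R ↥(LoopSubmodule (⇑(QuotientAddGroup.mk' H)) 𝒱.comp) where
  toFun := loopEndAdd 𝒱.comp g d hd
  map_add' := loopEndAdd_add 𝒱.comp g d hd
  map_smul' r x := by
    rw [RingHom.id_apply]
    revert r
    refine homog_smul_induction 𝒜 ?_ ?_ ?_
    · rw [zero_smul, zero_smul]
      apply Subtype.ext; ext a
      rw [loopEndAdd_apply]
      exact map_zero d
    · intro r s hr hs
      rw [add_smul, add_smul, loopEndAdd_add, hr, hs]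
    · intro k r hr
      apply Subtype.ext; ext a
      rw [loop_smul_apply 𝒜 _ hloop hr, loopEndAdd_apply, loopEndAdd_apply,
        loop_smul_apply 𝒜 _ hloop hr, map_smul]
      congr 3
      abel

lemma loopEnd_apply (𝒜 : AlgebraGrading F G R)
    (𝒱 : ModuleGrading 𝒜 (QuotientAddGroup.mk' H) V)
    [iL : Module R ↥(LoopSubmodule (⇑(QuotientAddGroup.mk' H)) 𝒱.comp)]
    (hloop : IsLoopSMul 𝒜 (AddMonoidHom.id G) (⇑(QuotientAddGroup.mk' H)) 𝒱.comp iL)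
    (g : G) (d : Module.End R V)
    (hd : IsHomogeneousEnd 𝒱.comp (QuotientAddGroup.mk' H g) d) (x) (a : G) :
    ((loopEnd 𝒜 𝒱 hloop g d hd x :
      ↥(LoopSubmodule (⇑(QuotientAddGroup.mk' H)) 𝒱.comp)) : G →₀ V) a
      = d ((x : G →₀ V) (a - g)) :=
  loopEndAdd_apply 𝒱.comp g d hd x a

end Helpers

/-- For a `G/H`-graded left `R`-module `V`, the loop algebra
`L_π(C^gr(V))`, identified with a subalgebra of `C^gr(L_π(V))` by
`(v ⊗ g)(d ⊗ g') = (v d) ⊗ (g + g')`, coincides with the centralizer of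
`L_π(F·1) = span{1 ⊗ h : h ∈ H}` in `C^gr(L_π(V))`. -/
theorem statement8 {F : Type*} [Field F] {G : Type*} [AddCommGroup G]
    {R : Type*} [Ring R] [Algebra F R] (H : AddSubgroup G)
    {V : Type*} [AddCommGroup V] [Module F V] [Module R V] [IsScalarTower F R V]
    (𝒜 : AlgebraGrading F G R)
    (𝒱 : ModuleGrading 𝒜 (QuotientAddGroup.mk' H) V)
    (iL : Module R ↥(LoopSubmodule (⇑(QuotientAddGroup.mk' H)) 𝒱.comp))
    (hloop : IsLoopSMul 𝒜 (AddMonoidHom.id G) (⇑(QuotientAddGroup.mk' H)) 𝒱.comp iL)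
    (δ : Module.End R ↥(LoopSubmodule (⇑(QuotientAddGroup.mk' H)) 𝒱.comp)) :
    (IsInGradedCentralizer (loopComp (⇑(QuotientAddGroup.mk' H)) 𝒱.comp) δ ∧
      ∀ (h : ↥H) (x : ↥(LoopSubmodule (⇑(QuotientAddGroup.mk' H)) 𝒱.comp)),
        δ (loopShift H 𝒱.comp h x) = loopShift H 𝒱.comp h (δ x))
    ↔
    (∃ (t : Finset G) (d : G → Module.End R V),
      (∀ g' ∈ t, IsHomogeneousEnd 𝒱.comp ((QuotientAddGroup.mk' H) g') (d g')) ∧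
      ∀ (x : ↥(LoopSubmodule (⇑(QuotientAddGroup.mk' H)) 𝒱.comp)) (a : G),
        (↑(δ x) : G →₀ V) a = ∑ g' ∈ t, (d g') ((↑x : G →₀ V) (a - g'))) := by
  classical
  have hcoe : ∀ (t : Finset G)
      (c : G → Module.End R ↥(LoopSubmodule (⇑(QuotientAddGroup.mk' H)) 𝒱.comp)) (x) (a : G),
      (((∑ g ∈ t, c g) x : ↥(LoopSubmodule (⇑(QuotientAddGroup.mk' H)) 𝒱.comp)) : G →₀ V) a
        = ∑ g ∈ t, ((c g x : ↥(LoopSubmodule (⇑(QuotientAddGroup.mk' H)) 𝒱.comp)) : G →₀ V) a := by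
    intro t c x a
    rw [LinearMap.sum_apply, Submodule.coe_sum, Finsupp.finsetSum_apply]
  constructor
  · rintro ⟨⟨t, c, hc, hδ⟩, hcomm⟩
    have hex : ∀ g ∈ t, ∃ d : Module.End R V,
        IsHomogeneousEnd 𝒱.comp (QuotientAddGroup.mk' H g) d ∧
        ∀ (x : ↥(LoopSubmodule (⇑(QuotientAddGroup.mk' H)) 𝒱.comp)) (a : G),
          ((c g x : ↥(LoopSubmodule (⇑(QuotientAddGroup.mk' H)) 𝒱.comp)) : G →₀ V) a
            = d ((x : G →₀ V) (a - g)) := by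
      intro g hg
      refine exists_end 𝒜 𝒱 hloop g (c g) (hc g hg) ?_
      have hval : ∀ a v hv, loopSum 𝒱.comp (c g (loopSingle 𝒱.comp a v hv))
          = ((δ (loopSingle 𝒱.comp a v hv) :
            ↥(LoopSubmodule (⇑(QuotientAddGroup.mk' H)) 𝒱.comp)) : G →₀ V) (a + g) := by
        intro a v hv
        rw [loopSum_of_mem _ _ _ (hc g hg (loopSingle_mem _ a v hv)), hδ, hcoe]
        rw [Finset.sum_eq_single_of_mem g hg]
        intro g' hg' hne
        refine hc g' hg' (loopSingle_mem _ a v hv) _ ?_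
        intro h
        exact hne (add_left_cancel h).symm
      intro a a' v hv hv' haa
      have hmem : a' - a ∈ H := by
        have : QuotientAddGroup.mk' H (a' - a) = 0 := by rw [map_sub, haa, sub_self]
        exact (QuotientAddGroup.eq_zero_iff _).mp this
      obtain ⟨h, rfl⟩ : ∃ h : ↥H, a' = a + (h : G) := ⟨⟨a' - a, hmem⟩, by simp⟩
      rw [hval, hval, ← loopShift_single 𝒱.comp _ a v hv hv', hcomm, loopShift_apply]
      congr 1
      abel
    choose! d hd1 hd2 using hex
    refine ⟨t, d, hd1, ?_⟩
    intro x a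
    rw [hδ, hcoe]
    exact Finset.sum_congr rfl fun g hg => hd2 g hg x a
  · rintro ⟨t, d, hd, hδ⟩
    constructor
    · refine ⟨t, fun g => if h : g ∈ t then loopEnd 𝒜 𝒱 hloop g (d g) (hd g h) else 0, ?_, ?_⟩
      · intro g hg
        simp only [dif_pos hg]
        intro k x hx b hb
        rw [loopEnd_apply, hx _ (fun h => hb (by rw [← h]; abel)), map_zero]
      · apply LinearMap.ext
        intro x
        apply Subtype.ext
        ext a
        rw [hδ, hcoe]
        refine Finset.sum_congr rfl fun g hg => ?_
        simp only [dif_pos hg]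
        rw [loopEnd_apply]
    · intro h x
      apply Subtype.ext
      ext a
      rw [loopShift_apply, hδ, hδ]
      refine Finset.sum_congr rfl fun g hg => ?_
      rw [loopShift_apply]
      congr 2
      abel

end GradedPaper
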